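/- The algebra $\mathbb{H}$ of quaternions, regarded as an algebra over the field $\mathbb{R}$ of real numbers, has no basis (as an $\mathbb{R}$-vector space) that is closed under multiplication. -/

import Mathlib

/-- A multiplicatively closed basis carries an augmentation: the linear functional equal to `1` on
the basis is multiplicative. -/
theorem exists_multiplicative_functional_of_mul_closed_basis {R A : Type*} [CommRing R] [Ring A]
    [Algebra R A] {H : Set A} (hli : LinearIndependent R ((↑) : H → A))
    (hspan : Submodule.span R H = ⊤) (hmul : ∀ x ∈ H, ∀ y ∈ H, x * y ∈ H) :
    ∃ f : A →ₗ[R] R, (∀ x ∈ H, f x = 1) ∧ ∀ x y, f (x * y) = f x * f y := by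
  let b := Module.Basis.mk hli (by simp [hspan])
  let f : A →ₗ[R] R := b.constr R fun _ => 1
  have hf : ∀ x ∈ H, f x = 1 := fun x hx => by
    simpa [b] using b.constr_basis R (fun _ => (1 : R)) ⟨x, hx⟩
  refine ⟨f, hf, fun x y => ?_⟩
  have key : (LinearMap.mul R A).compr₂ f = (LinearMap.mul R R).compl₁₂ f f := by
    refine b.ext fun i => b.ext fun j => ?_
    simp [b, hf _ i.2, hf _ j.2, hf _ (hmul _ i.2 _ j.2)]
  exact LinearMap.congr_fun₂ key x y

/-- The real quaternions have no `ℝ`-basis closed under multiplication. -/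
theorem quaternions_no_multiplicatively_closed_basis :
    ¬ ∃ H : Set (Quaternion ℝ),
        (LinearIndependent ℝ ((↑) : H → Quaternion ℝ) ∧ Submodule.span ℝ H = ⊤) ∧
        ∀ x ∈ H, ∀ y ∈ H, x * y ∈ H := by
  rintro ⟨H, ⟨hli, hspan⟩, hmul⟩
  obtain ⟨f, hf, hfmul⟩ := exists_multiplicative_functional_of_mul_closed_basis hli hspan hmul
  obtain ⟨h, hh⟩ : H.Nonempty := by
    rw [Set.nonempty_iff_ne_empty]
    rintro rfl
    simp at hspan
  have hone : f 1 = 1 := by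
    have := hfmul h 1
    rwa [mul_one, hf h hh, one_mul, eq_comm] at this
  let i : Quaternion ℝ := ⟨0, 1, 0, 0⟩
  have hi : i * i = -1 := by
    ext <;> simp only [Quaternion.re_mul, Quaternion.imI_mul, Quaternion.imJ_mul,
      Quaternion.imK_mul, Quaternion.re_neg, Quaternion.imI_neg, Quaternion.imJ_neg,
      Quaternion.imK_neg, Quaternion.re_one, Quaternion.imI_one, Quaternion.imJ_one,
      Quaternion.imK_one] <;> simp [i]
  have hsq := hfmul i i
  rw [hi, map_neg, hone] at hsq
  nlinarith [mul_self_nonneg (f i)]
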